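/- Let L > 0 and C > 0 be real numbers and let ω be a real number with ω > 1/(2√(CL)). Then in ℂ, (−i/(2ωC) + √(L/C − 1/(4ω²C²)))⁻¹ = i/(2Lω) + √(C/L − 1/(4L²ω²)), where both square roots are nonnegative real square roots (their arguments are positive since ω² > 1/(4CL)). -/

import Mathlib

/-- Yoon's effective impedance of the infinite CL-ladder at `λ = iω` agrees
with the admittance obtained as a right half-plane boundary limit:
`(−i/(2ωC) + √(L/C − 1/(4ω²C²)))⁻¹ = i/(2Lω) + √(C/L − 1/(4L²ω²))` in `ℂ`. -/
theorem yoon_impedance_admittance_identity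
    (L C : ℝ) (hL : 0 < L) (hC : 0 < C) (ω : ℝ)
    (hω : 1 / (2 * Real.sqrt (C * L)) < ω) :
    (-Complex.I / (2 * ω * C) +
        (Real.sqrt (L / C - 1 / (4 * ω ^ 2 * C ^ 2)) : ℂ))⁻¹ =
      Complex.I / (2 * L * ω) +
        (Real.sqrt (C / L - 1 / (4 * L ^ 2 * ω ^ 2)) : ℂ) := by
  have hq : 0 < Real.sqrt (C * L) := Real.sqrt_pos.mpr (by positivity)
  have hω0 : 0 < ω := lt_trans (by positivity) hω
  have hq2 : Real.sqrt (C * L) ^ 2 = C * L := Real.sq_sqrt (by positivity)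
  have h1 : 1 < 2 * ω * Real.sqrt (C * L) := by
    rw [div_lt_iff₀ (by positivity)] at hω
    linarith
  have h2 : 1 < 4 * ω ^ 2 * (C * L) := by
    rw [← hq2]
    nlinarith
  have hA : 0 ≤ L / C - 1 / (4 * ω ^ 2 * C ^ 2) := by
    have : L / C - 1 / (4 * ω ^ 2 * C ^ 2)
        = (4 * ω ^ 2 * (C * L) - 1) / (4 * ω ^ 2 * C ^ 2) := by
      field_simp
    rw [this]
    exact div_nonneg (by linarith) (by positivity)
  have hB : Real.sqrt (C / L - 1 / (4 * L ^ 2 * ω ^ 2))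
      = C / L * Real.sqrt (L / C - 1 / (4 * ω ^ 2 * C ^ 2)) := by
    have : C / L - 1 / (4 * L ^ 2 * ω ^ 2)
        = (C / L) ^ 2 * (L / C - 1 / (4 * ω ^ 2 * C ^ 2)) := by
      field_simp
    rw [this, Real.sqrt_mul (by positivity), Real.sqrt_sq (by positivity)]
  have hs := Real.sq_sqrt hA
  rw [hB]
  generalize Real.sqrt (L / C - 1 / (4 * ω ^ 2 * C ^ 2)) = s at hs
  have hs' : (s : ℂ) ^ 2 = L / C - 1 / (4 * ω ^ 2 * C ^ 2) := by
    exact_mod_cast congrArg (fun x : ℝ => (x : ℂ)) hs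
  have hLc : (L : ℂ) ≠ 0 := by exact_mod_cast hL.ne'
  have hCc : (C : ℂ) ≠ 0 := by exact_mod_cast hC.ne'
  have hωc : (ω : ℂ) ≠ 0 := by exact_mod_cast hω0.ne'
  apply inv_eq_of_mul_eq_one_right
  push_cast
  have e : (-Complex.I / (2 * ω * C) + (s : ℂ)) * (Complex.I / (2 * L * ω) + C / L * s)
      = -Complex.I ^ 2 / (4 * ω ^ 2 * C * L) + C / L * (s : ℂ) ^ 2 := by
    field_simp
    ring
  rw [e, hs', Complex.I_sq]
  field_simp
  ring
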